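/- arXiv:0905.4151 — 2 statements merged into one kernel-verified Lean document; each statement's English description precedes it below -/
import Mathlib

section
/- Let m be a bilinear multiplier of type (p₁,p₂,p₃), let m₁ be a bounded linear (s₁,p₁)-multiplier and m₂ a bounded linear (s₂,p₂)-multiplier. Then the function (ξ,η) ↦ m₁(ξ) m(ξ,η) m₂(η) is a bilinear multiplier of type (s₁,s₂,p₃), and ‖m₁ m m₂‖_{(s₁,s₂,p₃)} ≤ ‖m₁‖_{s₁,p₁} ‖m‖_{(p₁,p₂,p₃)} ‖m₂‖_{s₂,p₂}. -/
open MeasureTheory Set ENNReal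

noncomputable def FT (f : ℝ → ℂ) (ξ : ℝ) : ℂ :=
  ∫ x : ℝ, Complex.exp (-(2 * Real.pi * x * ξ) * Complex.I) * f x

noncomputable def FT2 (Φ : ℝ × ℝ → ℂ) (ξη : ℝ × ℝ) : ℂ :=
  ∫ uv : ℝ × ℝ, Complex.exp (-(2 * Real.pi * (ξη.1 * uv.1 + ξη.2 * uv.2)) * Complex.I) * Φ uv

/-- The class `𝒫(ℝ)`: Schwartz functions whose Fourier transform has compact support. -/
def MemP (f : ℝ → ℂ) : Prop :=
  (∃ φ : SchwartzMap ℝ ℂ, ⇑φ = f) ∧ HasCompactSupport (FT f)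

/-- The bilinear operator associated to a symbol `m` on `ℝ × ℝ`. -/
noncomputable def Bm (m : ℝ × ℝ → ℂ) (f g : ℝ → ℂ) (x : ℝ) : ℂ :=
  ∫ ξη : ℝ × ℝ, FT f ξη.1 * FT g ξη.2 * m ξη *
    Complex.exp ((2 * Real.pi * (ξη.1 + ξη.2) * x) * Complex.I)

/-- `m` is a bilinear multiplier of type `(p₁, p₂, p₃)`. -/
def IsBiMult (p₁ p₂ p₃ : ℝ≥0∞) (m : ℝ × ℝ → ℂ) : Prop :=
  ∃ C : ℝ, 0 < C ∧ ∀ f g : ℝ → ℂ, MemP f → MemP g →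
    eLpNorm (Bm m f g) p₃ volume ≤
      ENNReal.ofReal C * eLpNorm f p₁ volume * eLpNorm g p₂ volume

/-- The multiplier norm `‖m‖_{(p₁,p₂,p₃)}`: the least admissible constant. -/
noncomputable def biNorm (p₁ p₂ p₃ : ℝ≥0∞) (m : ℝ × ℝ → ℂ) : ℝ :=
  sInf {C : ℝ | 0 ≤ C ∧ ∀ f g : ℝ → ℂ, MemP f → MemP g →
    eLpNorm (Bm m f g) p₃ volume ≤
      ENNReal.ofReal C * eLpNorm f p₁ volume * eLpNorm g p₂ volume}

/-- The linear multiplier operator `T_{m₁}` given by `(T_{m₁} f)^ = m₁ f̂`, realized on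
functions in `𝒫(ℝ)` via Fourier inversion. -/
noncomputable def Tlin (m₁ : ℝ → ℂ) (f : ℝ → ℂ) (x : ℝ) : ℂ :=
  ∫ ξ : ℝ, m₁ ξ * FT f ξ * Complex.exp ((2 * Real.pi * ξ * x) * Complex.I)

/-- `m₁` is a bounded linear `(s,p)`-multiplier. -/
def IsLinMult (s p : ℝ≥0∞) (m₁ : ℝ → ℂ) : Prop :=
  ∃ C : ℝ, 0 < C ∧ ∀ f : ℝ → ℂ, MemP f →
    eLpNorm (Tlin m₁ f) p volume ≤ ENNReal.ofReal C * eLpNorm f s volume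

/-- The linear multiplier norm `‖m₁‖_{s,p}`. -/
noncomputable def linNorm (s p : ℝ≥0∞) (m₁ : ℝ → ℂ) : ℝ :=
  sInf {C : ℝ | 0 ≤ C ∧ ∀ f : ℝ → ℂ, MemP f →
    eLpNorm (Tlin m₁ f) p volume ≤ ENNReal.ofReal C * eLpNorm f s volume}

open FourierTransform in
theorem FT_eq_fourier (f : ℝ → ℂ) : FT f = 𝓕 f := by
  ext ξ
  rw [Real.fourier_real_eq_integral_exp_smul]
  unfold FT
  congr with x
  push_cast
  rw [smul_eq_mul]
  congr 2
  ring

open FourierTransform in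
theorem Tlin_eq_fourierInv (m f : ℝ → ℂ) : Tlin m f = 𝓕⁻ (fun ξ => m ξ * FT f ξ) := by
  ext x
  rw [Real.fourierInv_eq']
  unfold Tlin
  congr with ξ
  rw [smul_eq_mul, mul_comm]
  congr 2
  simp
  ring

theorem MemP.continuous_FT {f : ℝ → ℂ} (hf : MemP f) : Continuous (FT f) := by
  obtain ⟨⟨φ, rfl⟩, -⟩ := hf
  rw [FT_eq_fourier, ← SchwartzMap.fourier_coe]
  exact SchwartzMap.continuous _

open FourierTransform in
/-- The Fourier inverse of a smooth compactly supported function belongs to `𝒫(ℝ)`. -/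
theorem memP_fourierInv_and_FT_eq {G : ℝ → ℂ} (hG : HasCompactSupport G)
    (hG' : ContDiff ℝ ((⊤ : ℕ∞) : WithTop ℕ∞) G) : MemP (𝓕⁻ G) ∧ FT (𝓕⁻ G) = G := by
  have h : 𝓕⁻ G = ⇑(𝓕⁻ (hG.toSchwartzMap hG') : SchwartzMap ℝ ℂ) := by
    rw [SchwartzMap.fourierInv_coe]
    rfl
  have h2 : FT (𝓕⁻ G) = G := by
    rw [FT_eq_fourier, h, ← SchwartzMap.fourier_coe, FourierTransform.fourier_fourierInv_eq]
    rfl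
  exact ⟨⟨⟨_, h.symm⟩, h2.symm ▸ hG⟩, h2⟩

open Convolution in
theorem norm_normed_convolution_le (φ : ContDiffBump (0 : ℝ)) {F : ℝ → ℂ} {B : ℝ}
    (hB : ∀ ξ, ‖F ξ‖ ≤ B) (ξ : ℝ) :
    ‖(φ.normed volume ⋆[ContinuousLinearMap.lsmul ℝ ℝ, volume] F) ξ‖ ≤ B := by
  have h : ‖(φ.normed volume ⋆[ContinuousLinearMap.lsmul ℝ ℝ, volume] F) ξ‖ ≤
      ∫ t, φ.normed volume t * B := by
    refine norm_integral_le_of_norm_le (φ.integrable_normed.mul_const B) (.of_forall fun t => ?_)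
    rw [ContinuousLinearMap.lsmul_apply, norm_smul, Real.norm_of_nonneg (φ.nonneg_normed t)]
    exact mul_le_mul_of_nonneg_left (hB _) (φ.nonneg_normed t)
  rwa [integral_mul_const, φ.integral_normed, one_mul] at h

open FourierTransform Convolution in
theorem norm_fourierInv_normed_convolution_le (φ : ContDiffBump (0 : ℝ)) {F : ℝ → ℂ}
    (hF : Integrable F) (x : ℝ) :
    ‖𝓕⁻ (φ.normed volume ⋆[ContinuousLinearMap.lsmul ℝ ℝ, volume] F) x‖ ≤ ‖𝓕⁻ F x‖ := by
  have h : (φ.normed volume ⋆[ContinuousLinearMap.lsmul ℝ ℝ, volume] F) =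
      (fun t => (φ.normed volume t : ℂ)) ⋆[ContinuousLinearMap.lsmul ℂ ℂ, volume] F := by
    ext ξ
    simp [convolution_def]
  rw [Real.fourierInv_eq_fourier_neg, Real.fourierInv_eq_fourier_neg, h,
    Real.fourier_smul_convolution_eq (f₁ := fun t => (φ.normed volume t : ℂ)) φ.integrable_normed.ofReal hF, norm_smul]
  refine mul_le_of_le_one_left (norm_nonneg _) ?_
  rw [Real.fourier_eq]
  refine (norm_integral_le_integral_norm _).trans_eq ?_
  rw [← φ.integral_normed (μ := volume)]
  congr with t
  rw [Circle.norm_smul, Complex.norm_real, Real.norm_of_nonneg (φ.nonneg_normed t)]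

open Filter Topology FourierTransform Convolution in
/-- Functions whose Fourier transform is bounded and compactly supported are approximated by
functions in `𝒫(ℝ)` which they dominate. -/
theorem exists_seq_memP_approx {F : ℝ → ℂ} (hF : Measurable F) {B R : ℝ}
    (hB : ∀ ξ, ‖F ξ‖ ≤ B) (hR : Function.support F ⊆ Metric.closedBall 0 R) :
    ∃ h : ℕ → ℝ → ℂ, (∀ n, MemP (h n)) ∧
      (∀ᵐ ξ, Tendsto (fun n => FT (h n) ξ) atTop (𝓝 (F ξ))) ∧
      (∀ n ξ, ‖FT (h n) ξ‖ ≤ B) ∧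
      (∀ n, Function.support (FT (h n)) ⊆ Metric.closedBall 0 (1 + R)) ∧
      ∀ n x, ‖h n x‖ ≤ ‖𝓕⁻ F x‖ := by
  have hFi : Integrable F := by
    rw [← integrableOn_iff_integrable_of_support_subset hR]
    exact Measure.integrableOn_of_bounded (isCompact_closedBall _ _).measure_lt_top.ne
      hF.aestronglyMeasurable (.of_forall hB)
  have hFc : HasCompactSupport F :=
    HasCompactSupport.of_support_subset_isCompact (isCompact_closedBall _ _) hR
  let φ : ℕ → ContDiffBump (0 : ℝ) := fun n =>
    ⟨1 / ((n : ℝ) + 1) / 2, 1 / ((n : ℝ) + 1), by positivity, half_lt_self (by positivity)⟩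
  let G : ℕ → ℝ → ℂ := fun n =>
    (φ n).normed volume ⋆[ContinuousLinearMap.lsmul ℝ ℝ, volume] F
  have key : ∀ n, MemP (𝓕⁻ (G n)) ∧ FT (𝓕⁻ (G n)) = G n := fun n =>
    memP_fourierInv_and_FT_eq ((φ n).hasCompactSupport_normed.convolution _ hFc)
      ((φ n).hasCompactSupport_normed.contDiff_convolution_left _ (φ n).contDiff_normed
        hFi.locallyIntegrable)
  refine ⟨fun n => 𝓕⁻ (G n), fun n => (key n).1, ?_, fun n ξ => ?_, fun n => ?_, fun n x =>
    norm_fourierInv_normed_convolution_le (φ n) hFi x⟩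
  · simp only [(key _).2]
    exact ContDiffBump.ae_convolution_tendsto_right_of_locallyIntegrable (K := 2)
      tendsto_one_div_add_atTop_nhds_zero_nat
      (.of_forall fun n => (mul_div_cancel₀ _ two_ne_zero).ge) hFi.locallyIntegrable
  · rw [(key n).2]
    exact norm_normed_convolution_le (φ n) hB ξ
  · rw [(key n).2]
    refine (support_convolution_subset _).trans ?_
    rintro _ ⟨a, ha, b, hb, rfl⟩
    rw [(φ n).support_normed_eq, mem_ball_zero_iff] at ha
    have hb' := mem_closedBall_zero_iff.1 (hR hb)
    have h1 : (φ n).rOut ≤ 1 := by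
      change 1 / ((n : ℝ) + 1) ≤ 1
      rw [div_le_one (by positivity)]
      linarith [n.cast_nonneg (α := ℝ)]
    exact mem_closedBall_zero_iff.2 ((norm_add_le a b).trans (by linarith))

theorem norm_bilinear_integrand_le {m : ℝ × ℝ → ℂ} {F G : ℝ → ℂ} {A B R S : ℝ}
    (hA : ∀ ξ, ‖F ξ‖ ≤ A) (hB : ∀ ξ, ‖G ξ‖ ≤ B)
    (hR : Function.support F ⊆ Metric.closedBall 0 R)
    (hS : Function.support G ⊆ Metric.closedBall 0 S) (x : ℝ) (ξη : ℝ × ℝ) :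
    ‖F ξη.1 * G ξη.2 * m ξη * Complex.exp ((2 * Real.pi * (ξη.1 + ξη.2) * x) * Complex.I)‖ ≤
      (Metric.closedBall (0 : ℝ) R ×ˢ Metric.closedBall (0 : ℝ) S).indicator
        (fun ξη => A * B * ‖m ξη‖) ξη := by
  have hexp : ‖Complex.exp ((2 * Real.pi * (ξη.1 + ξη.2) * x) * Complex.I)‖ = 1 := by
    exact_mod_cast Complex.norm_exp_ofReal_mul_I (2 * Real.pi * (ξη.1 + ξη.2) * x)
  rw [norm_mul, hexp, mul_one]
  by_cases h : ξη ∈ Metric.closedBall (0 : ℝ) R ×ˢ Metric.closedBall (0 : ℝ) S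
  · rw [indicator_of_mem h, norm_mul, norm_mul]
    have := (norm_nonneg _).trans (hA ξη.1)
    gcongr
    exacts [hA _, hB _]
  · rw [indicator_of_notMem h]
    have : F ξη.1 = 0 ∨ G ξη.2 = 0 := by
      by_contra! h'
      exact h ⟨hR h'.1, hS h'.2⟩
    rcases this with h' | h' <;> simp [h']

theorem integrable_indicator_bound {m : ℝ × ℝ → ℂ} (hm : LocallyIntegrable m volume)
    (A R S : ℝ) : Integrable
      ((Metric.closedBall (0 : ℝ) R ×ˢ Metric.closedBall (0 : ℝ) S).indicator
        (fun ξη => A * ‖m ξη‖)) := by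
  rw [integrable_indicator_iff (measurableSet_closedBall.prod measurableSet_closedBall)]
  exact ((hm.integrableOn_isCompact
    ((isCompact_closedBall _ _).prod (isCompact_closedBall _ _))).norm.const_mul A)

theorem aestronglyMeasurable_bilinear_integrand {m : ℝ × ℝ → ℂ}
    (hm : AEStronglyMeasurable m volume) {F G : ℝ → ℂ} (hF : Measurable F) (hG : Measurable G)
    (x : ℝ) : AEStronglyMeasurable (fun ξη : ℝ × ℝ => F ξη.1 * G ξη.2 * m ξη *
      Complex.exp ((2 * Real.pi * (ξη.1 + ξη.2) * x) * Complex.I)) volume := by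
  refine AEStronglyMeasurable.mul (.mul ?_ hm) ?_
  · exact (by fun_prop : Measurable fun ξη : ℝ × ℝ => F ξη.1 * G ξη.2).aestronglyMeasurable
  · exact (by fun_prop : Continuous fun ξη : ℝ × ℝ =>
      Complex.exp ((2 * Real.pi * (ξη.1 + ξη.2) * x) * Complex.I)).aestronglyMeasurable

theorem continuous_Bm {m : ℝ × ℝ → ℂ} (hm : LocallyIntegrable m volume) {f g : ℝ → ℂ}
    (hf : MemP f) (hg : MemP g) {A B R S : ℝ}
    (hA : ∀ ξ, ‖FT f ξ‖ ≤ A) (hB : ∀ ξ, ‖FT g ξ‖ ≤ B)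
    (hR : Function.support (FT f) ⊆ Metric.closedBall 0 R)
    (hS : Function.support (FT g) ⊆ Metric.closedBall 0 S) : Continuous (Bm m f g) :=
  continuous_of_dominated
    (fun x => aestronglyMeasurable_bilinear_integrand hm.aestronglyMeasurable
      hf.continuous_FT.measurable hg.continuous_FT.measurable x)
    (fun x => .of_forall (norm_bilinear_integrand_le hA hB hR hS x))
    (integrable_indicator_bound hm _ R S)
    (.of_forall fun ξη => by fun_prop)

theorem MemP.exists_bounds {f μ : ℝ → ℂ} (hf : MemP f) (hμ : ∃ B : ℝ, ∀ ξ, ‖μ ξ‖ ≤ B) :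
    ∃ A R : ℝ, (∀ ξ, ‖μ ξ * FT f ξ‖ ≤ A) ∧
      Function.support (fun ξ => μ ξ * FT f ξ) ⊆ Metric.closedBall 0 R := by
  obtain ⟨B, hB⟩ := hμ
  obtain ⟨C, hC⟩ := hf.2.exists_bound_of_continuous hf.continuous_FT
  obtain ⟨R, hR⟩ := hf.2.isCompact.isBounded.subset_closedBall 0
  refine ⟨B * C, R, fun ξ => ?_, fun ξ hξ => hR (subset_tsupport _ (right_ne_zero_of_mul hξ))⟩
  rw [norm_mul]
  exact mul_le_mul (hB ξ) (hC ξ) (norm_nonneg _) ((norm_nonneg _).trans (hB ξ))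

open Filter Topology in
theorem eLpNorm_Bm_mul_le {p₁ p₂ p₃ : ℝ≥0∞} {m : ℝ × ℝ → ℂ} (hm : LocallyIntegrable m volume)
    {c : ℝ≥0∞} (hc : ∀ f g : ℝ → ℂ, MemP f → MemP g →
      eLpNorm (Bm m f g) p₃ volume ≤ c * eLpNorm f p₁ volume * eLpNorm g p₂ volume)
    {m₁ m₂ : ℝ → ℂ} (hm₁ : Measurable m₁) (hm₂ : Measurable m₂)
    (hb₁ : ∃ B : ℝ, ∀ ξ, ‖m₁ ξ‖ ≤ B) (hb₂ : ∃ B : ℝ, ∀ η, ‖m₂ η‖ ≤ B)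
    {f g : ℝ → ℂ} (hf : MemP f) (hg : MemP g) :
    eLpNorm (Bm (fun ξη => m₁ ξη.1 * m ξη * m₂ ξη.2) f g) p₃ volume ≤
      c * eLpNorm (Tlin m₁ f) p₁ volume * eLpNorm (Tlin m₂ g) p₂ volume := by
  obtain ⟨A, R, hA, hR⟩ := hf.exists_bounds hb₁
  obtain ⟨B, S, hB, hS⟩ := hg.exists_bounds hb₂
  obtain ⟨h, hP, hlim, hhA, hhR, hdom⟩ :=
    exists_seq_memP_approx (hm₁.mul hf.continuous_FT.measurable) hA hR
  obtain ⟨k, kP, klim, kkB, kkS, kdom⟩ :=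
    exists_seq_memP_approx (hm₂.mul hg.continuous_FT.measurable) hB hS
  have tend : ∀ x, Tendsto (fun n => Bm m (h n) (k n) x) atTop
      (𝓝 (Bm (fun ξη => m₁ ξη.1 * m ξη * m₂ ξη.2) f g x)) := by
    intro x
    refine tendsto_integral_of_dominated_convergence _
      (fun n => aestronglyMeasurable_bilinear_integrand hm.aestronglyMeasurable
        (hP n).continuous_FT.measurable (kP n).continuous_FT.measurable x)
      (integrable_indicator_bound hm (A * B) (1 + R) (1 + S))
      (fun n => .of_forall (norm_bilinear_integrand_le (hhA n) (kkB n) (hhR n) (kkS n) x)) ?_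
    filter_upwards [Measure.quasiMeasurePreserving_fst.ae hlim,
      Measure.quasiMeasurePreserving_snd.ae klim] with ξη h1 h2
    have h3 := ((h1.mul h2).mul_const (m ξη)).mul_const
      (Complex.exp ((2 * Real.pi * (ξη.1 + ξη.2) * x) * Complex.I))
    convert h3 using 2
    simp only [Pi.mul_apply]
    ring
  refine Lp.eLpNorm_le_of_ae_tendsto (u := atTop) (f := fun n => Bm m (h n) (k n)) (.of_forall fun n => ?_)
    (fun n => (continuous_Bm hm (hP n) (kP n) (hhA n) (kkB n) (hhR n)
      (kkS n)).aestronglyMeasurable) (.of_forall tend)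
  rw [Tlin_eq_fourierInv, Tlin_eq_fourierInv]
  refine (hc _ _ (hP n) (kP n)).trans ?_
  gcongr
  · exact eLpNorm_mono (hdom n)
  · exact eLpNorm_mono (kdom n)

theorem le_csInf_mul {S : Set ℝ} (hS : S.Nonempty) {x y : ℝ} (hy : 0 ≤ y)
    (h : ∀ a ∈ S, x ≤ a * y) : x ≤ sInf S * y := by
  rcases hy.eq_or_lt with rfl | hy
  · obtain ⟨a, ha⟩ := hS
    simpa using h a ha
  · rw [← div_le_iff₀ hy]
    exact le_csInf hS fun a ha => (div_le_iff₀ hy).2 (h a ha)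

theorem stmt3 (p₁ p₂ p₃ s₁ s₂ : ℝ≥0∞) (hp₁ : 1 ≤ p₁) (hp₂ : 1 ≤ p₂) (hp₃ : 0 < p₃)
    (hs₁ : 1 ≤ s₁) (hs₂ : 1 ≤ s₂)
    (m : ℝ × ℝ → ℂ) (hmloc : LocallyIntegrable m volume)
    (hm : IsBiMult p₁ p₂ p₃ m)
    (m₁ m₂ : ℝ → ℂ) (hm₁meas : Measurable m₁) (hm₂meas : Measurable m₂)
    (hm₁bd : ∃ B : ℝ, ∀ ξ, ‖m₁ ξ‖ ≤ B) (hm₂bd : ∃ B : ℝ, ∀ η, ‖m₂ η‖ ≤ B)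
    (hm₁ : IsLinMult s₁ p₁ m₁) (hm₂ : IsLinMult s₂ p₂ m₂) :
    IsBiMult s₁ s₂ p₃ (fun ξη => m₁ ξη.1 * m ξη * m₂ ξη.2) ∧
    biNorm s₁ s₂ p₃ (fun ξη => m₁ ξη.1 * m ξη * m₂ ξη.2) ≤
      linNorm s₁ p₁ m₁ * biNorm p₁ p₂ p₃ m * linNorm s₂ p₂ m₂ := by
  have key : ∀ a b c : ℝ, 0 ≤ a → 0 ≤ b → 0 ≤ c →
      (∀ f : ℝ → ℂ, MemP f →
        eLpNorm (Tlin m₁ f) p₁ volume ≤ ENNReal.ofReal a * eLpNorm f s₁ volume) →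
      (∀ f g : ℝ → ℂ, MemP f → MemP g → eLpNorm (Bm m f g) p₃ volume ≤
        ENNReal.ofReal b * eLpNorm f p₁ volume * eLpNorm g p₂ volume) →
      (∀ f : ℝ → ℂ, MemP f →
        eLpNorm (Tlin m₂ f) p₂ volume ≤ ENNReal.ofReal c * eLpNorm f s₂ volume) →
      ∀ f g : ℝ → ℂ, MemP f → MemP g →
        eLpNorm (Bm (fun ξη => m₁ ξη.1 * m ξη * m₂ ξη.2) f g) p₃ volume ≤
          ENNReal.ofReal (a * b * c) * eLpNorm f s₁ volume * eLpNorm g s₂ volume := by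
    intro a b c ha hb hc h₁ h h₂ f g hf hg
    calc _ ≤ ENNReal.ofReal b * eLpNorm (Tlin m₁ f) p₁ volume *
            eLpNorm (Tlin m₂ g) p₂ volume :=
          eLpNorm_Bm_mul_le hmloc h hm₁meas hm₂meas hm₁bd hm₂bd hf hg
      _ ≤ ENNReal.ofReal b * (ENNReal.ofReal a * eLpNorm f s₁ volume) *
            (ENNReal.ofReal c * eLpNorm g s₂ volume) := by
          gcongr
          exacts [h₁ f hf, h₂ g hg]
      _ = _ := by
          rw [ENNReal.ofReal_mul (mul_nonneg ha hb), ENNReal.ofReal_mul ha]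
          ring
  obtain ⟨a, ha, h₁⟩ := hm₁
  obtain ⟨b, hb, h⟩ := hm
  obtain ⟨c, hc, h₂⟩ := hm₂
  refine ⟨⟨a * b * c, by positivity, key a b c ha.le hb.le hc.le h₁ h h₂⟩, ?_⟩
  have hbi : 0 ≤ biNorm p₁ p₂ p₃ m := Real.sInf_nonneg fun _ h => h.1
  have hlin : 0 ≤ linNorm s₂ p₂ m₂ := Real.sInf_nonneg fun _ h => h.1
  rw [mul_assoc]
  refine le_csInf_mul (by exact ⟨a, ha.le, h₁⟩) (mul_nonneg hbi hlin) fun a' ha' => ?_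
  rw [mul_left_comm]
  refine le_csInf_mul (by exact ⟨b, hb.le, h⟩) (mul_nonneg ha'.1 hlin) fun b' hb' => ?_
  rw [← mul_assoc, mul_comm]
  refine le_csInf_mul (by exact ⟨c, hc.le, h₂⟩) (mul_nonneg hb'.1 ha'.1) fun c' hc' => ?_
  rw [mul_comm c', mul_comm b']
  exact csInf_le ⟨0, fun _ h => h.1⟩ ⟨mul_nonneg (mul_nonneg ha'.1 hb'.1) hc'.1,
    key a' b' c' ha'.1 hb'.1 hc'.1 ha'.2 hb'.2 hc'.2⟩
end

section
/- Let M : ℝ → ℂ belong to the class M̃_{(p₁,p₂,p₃)} and define q by 1/q = 1/p₁ + 1/p₂ − 1/p₃. Then there exists a constant C > 0 such that for every λ > 0, |∫_ℝ e^{−λ²ξ²} M(ξ) dξ| ≤ C ‖M‖_{(p₁,p₂,p₃)} λ^{1/q − 1}. -/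
open MeasureTheory Set ENNReal

open FourierTransform in
theorem norm_fourierInv_le_integral_norm (f : ℝ → ℂ) (x : ℝ) :
    ‖𝓕⁻ f x‖ ≤ ∫ y, ‖f y‖ := by
  rw [Real.fourierInv_eq_fourier_neg]
  exact VectorFourier.norm_fourierIntegral_le_integral_norm _ _ _ _ _

open FourierTransform in
theorem norm_fourierInv_le_of_hasDerivAt {f f' f'' : ℝ → ℂ}
    (hf : Integrable f) (hf' : Integrable f') (hf'' : Integrable f'')
    (h₁ : ∀ x, HasDerivAt f (f' x) x) (h₂ : ∀ x, HasDerivAt f' (f'' x) x) (x : ℝ) :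
    ‖𝓕⁻ f x‖ ≤ ((∫ y, ‖f y‖) + ∫ y, ‖f'' y‖) * (1 + x ^ 2)⁻¹ := by
  have e₁ : deriv f = f' := funext fun x => (h₁ x).deriv
  have e₂ : deriv f' = f'' := funext fun x => (h₂ x).deriv
  have k₁ := Real.fourier_deriv hf (fun x => (h₁ x).differentiableAt) (e₁ ▸ hf')
  have k₂ := Real.fourier_deriv hf' (fun x => (h₂ x).differentiableAt) (e₂ ▸ hf'')
  rw [e₁] at k₁
  rw [e₂, k₁] at k₂
  have h0 := norm_fourierInv_le_integral_norm f x
  have h2 := norm_fourierInv_le_integral_norm f'' x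
  rw [Real.fourierInv_eq_fourier_neg, k₂] at h2
  beta_reduce at h2
  rw [← Real.fourierInv_eq_fourier_neg] at h2
  simp only [norm_smul, norm_mul, Complex.norm_real, Complex.norm_I, norm_neg, Real.norm_eq_abs,
    abs_of_pos Real.pi_pos, Complex.norm_ofNat, mul_one, Complex.ofReal_neg] at h2
  rw [← div_eq_mul_inv, le_div_iff₀ (by positivity)]
  have hpi := Real.pi_gt_three
  have hx : x ^ 2 = |x| * |x| := by rw [← sq, sq_abs]
  have : x ^ 2 * ‖𝓕⁻ f x‖ ≤ 2 * Real.pi * |x| * (2 * Real.pi * |x| * ‖𝓕⁻ f x‖) := by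
    rw [hx]
    have : 0 ≤ |x| * |x| * ‖𝓕⁻ f x‖ := by positivity
    nlinarith [mul_nonneg this (show 0 ≤ 4 * Real.pi ^ 2 - 1 by nlinarith)]
  linarith

theorem integrable_sq_add_mul_exp (a b : ℝ) :
    Integrable fun x : ℝ => (a + b * x ^ 2) * Real.exp (-2 * x ^ 2) := by
  have h1 := integrable_exp_neg_mul_sq (b := 2) (by norm_num)
  have h2 := integrable_rpow_mul_exp_neg_mul_sq (b := 2) (s := 2) (by norm_num) (by norm_num)
  refine ((h1.const_mul a).add (h2.const_mul b)).congr (.of_forall fun x => ?_)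
  simp only [Pi.add_apply, Real.rpow_two]
  ring

theorem exists_smooth_cutoff : ∃ (χ χ' χ'' : ℝ → ℝ) (B : ℝ), 1 ≤ B ∧ ContDiff ℝ (⊤ : ℕ∞) χ ∧
    HasCompactSupport χ ∧ (∀ x, HasDerivAt χ (χ' x) x) ∧ (∀ x, HasDerivAt χ' (χ'' x) x) ∧
    Continuous χ'' ∧ χ 0 = 1 ∧ (∀ x, |χ x| ≤ 1) ∧ (∀ x, |χ' x| ≤ B) ∧ ∀ x, |χ'' x| ≤ B := by
  let c : ContDiffBump (0 : ℝ) := ⟨1, 2, one_pos, one_lt_two⟩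
  have hc : ContDiff ℝ (⊤ : ℕ∞) c := c.contDiff
  have hc1 : ContDiff ℝ (⊤ : ℕ∞) (deriv c) := ((contDiff_infty_iff_deriv (𝕜 := ℝ)).1 hc).2
  have hc2 : ContDiff ℝ (⊤ : ℕ∞) (deriv (deriv c)) := ((contDiff_infty_iff_deriv (𝕜 := ℝ)).1 hc1).2
  have hs : HasCompactSupport c := c.hasCompactSupport
  obtain ⟨B₁, hB₁⟩ := hs.deriv.exists_bound_of_continuous hc1.continuous
  obtain ⟨B₂, hB₂⟩ := hs.deriv.deriv.exists_bound_of_continuous hc2.continuous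
  refine ⟨c, deriv c, deriv (deriv c), max 1 (max B₁ B₂), le_max_left _ _, hc, hs,
    fun x => (hc.differentiable (by simp) x).hasDerivAt,
    fun x => (hc1.differentiable (by simp) x).hasDerivAt, hc2.continuous,
    c.one_of_mem_closedBall (by simp [c]), fun x => ?_, fun x => ?_, fun x => ?_⟩
  · rw [abs_of_nonneg c.nonneg]
    exact c.le_one
  · exact (hB₁ x).trans ((le_max_left _ _).trans (le_max_right _ _))
  · exact (hB₂ x).trans ((le_max_right _ _).trans (le_max_right _ _))

open FourierTransform in
theorem norm_fourierInv_cutoff_gaussian_le {χ χ' χ'' : ℝ → ℝ} {B : ℝ} (hB : 1 ≤ B)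
    (hχ : ∀ x, HasDerivAt χ (χ' x) x) (hχ' : ∀ x, HasDerivAt χ' (χ'' x) x)
    (hc : Continuous χ'') (b₀ : ∀ x, |χ x| ≤ 1) (b₁ : ∀ x, |χ' x| ≤ B) (b₂ : ∀ x, |χ'' x| ≤ B)
    {ε : ℝ} (hε₀ : 0 ≤ ε) (hε₁ : ε ≤ 1) (x : ℝ) :
    ‖𝓕⁻ (fun ξ : ℝ => ((χ (ε * ξ) * Real.exp (-2 * ξ ^ 2) : ℝ) : ℂ)) x‖ ≤
      (2 * ∫ ξ : ℝ, (B * 9 + B * 20 * ξ ^ 2) * Real.exp (-2 * ξ ^ 2)) * (1 + x ^ 2)⁻¹ := by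
  have hcχ : Continuous χ := continuous_iff_continuousAt.2 fun x => (hχ x).continuousAt
  have hcχ' : Continuous χ' := continuous_iff_continuousAt.2 fun x => (hχ' x).continuousAt
  let u : ℝ → ℝ := fun ξ => χ (ε * ξ) * Real.exp (-2 * ξ ^ 2)
  let u' : ℝ → ℝ := fun ξ => (ε * χ' (ε * ξ) - 4 * ξ * χ (ε * ξ)) * Real.exp (-2 * ξ ^ 2)
  let u'' : ℝ → ℝ := fun ξ => (ε ^ 2 * χ'' (ε * ξ) - 8 * ξ * (ε * χ' (ε * ξ)) +
    (16 * ξ ^ 2 - 4) * χ (ε * ξ)) * Real.exp (-2 * ξ ^ 2)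
  have hE (ξ : ℝ) : HasDerivAt (fun ξ : ℝ => Real.exp (-2 * ξ ^ 2))
      (Real.exp (-2 * ξ ^ 2) * (-4 * ξ)) ξ := by
    refine ((hasDerivAt_pow 2 ξ).const_mul (-2)).exp.congr_deriv ?_
    norm_num; ring_nf
  have hL (ξ : ℝ) : HasDerivAt (fun ξ : ℝ => ε * ξ) ε ξ := by
    simpa using (hasDerivAt_id ξ).const_mul ε
  have hX (ξ : ℝ) : HasDerivAt (fun ξ => χ (ε * ξ)) (χ' (ε * ξ) * ε) ξ := (hχ _).comp ξ (hL ξ)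
  have hX' (ξ : ℝ) : HasDerivAt (fun ξ => χ' (ε * ξ)) (χ'' (ε * ξ) * ε) ξ :=
    (hχ' _).comp ξ (hL ξ)
  have h₁ (ξ : ℝ) : HasDerivAt u (u' ξ) ξ := by
    refine ((hX ξ).mul (hE ξ)).congr_deriv ?_
    simp only [u']; ring
  have h₂ (ξ : ℝ) : HasDerivAt u' (u'' ξ) ξ := by
    refine ((((hX' ξ).const_mul ε).sub (((hasDerivAt_id ξ).const_mul 4).mul (hX ξ))).mul
      (hE ξ)).congr_deriv ?_
    simp only [u'', Pi.sub_apply, Pi.mul_apply, id]; ring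
  have hint := integrable_sq_add_mul_exp (B * 9) (B * 20)
  have dom {P : ℝ → ℝ} (hP : ∀ ξ, |P ξ| ≤ B * 9 + B * 20 * ξ ^ 2) (ξ : ℝ) :
      ‖((P ξ * Real.exp (-2 * ξ ^ 2) : ℝ) : ℂ)‖ ≤
        (B * 9 + B * 20 * ξ ^ 2) * Real.exp (-2 * ξ ^ 2) := by
    rw [Complex.norm_real, Real.norm_eq_abs, abs_mul, abs_of_pos (Real.exp_pos _)]
    exact mul_le_mul_of_nonneg_right (hP ξ) (Real.exp_pos _).le
  have aux (ξ : ℝ) : |ξ| ≤ (1 + ξ ^ 2) / 2 := by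
    nlinarith [sq_nonneg (|ξ| - 1), sq_abs ξ]
  have c₁ (ξ : ℝ) : |ε * χ' (ε * ξ)| ≤ B := by
    rw [abs_mul, abs_of_nonneg hε₀]
    nlinarith [b₁ (ε * ξ), abs_nonneg (χ' (ε * ξ))]
  have c₂ (ξ : ℝ) : |ε ^ 2 * χ'' (ε * ξ)| ≤ B := by
    rw [abs_mul, abs_of_nonneg (sq_nonneg ε)]
    have : ε ^ 2 ≤ 1 := by nlinarith
    nlinarith [b₂ (ε * ξ), abs_nonneg (χ'' (ε * ξ))]
  have d₀ (ξ : ℝ) : |χ (ε * ξ)| ≤ B * 9 + B * 20 * ξ ^ 2 := by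
    nlinarith [b₀ (ε * ξ), mul_nonneg (zero_le_one.trans hB) (sq_nonneg ξ)]
  have d₁ (ξ : ℝ) : |ε * χ' (ε * ξ) - 4 * ξ * χ (ε * ξ)| ≤ B * 9 + B * 20 * ξ ^ 2 := by
    have t : |4 * ξ * χ (ε * ξ)| ≤ 2 * (1 + ξ ^ 2) := by
      rw [abs_mul, abs_mul, abs_of_pos (by norm_num : (0 : ℝ) < 4)]
      nlinarith [b₀ (ε * ξ), aux ξ, abs_nonneg ξ]
    have := abs_sub (ε * χ' (ε * ξ)) (4 * ξ * χ (ε * ξ))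
    nlinarith [c₁ ξ, mul_nonneg (sub_nonneg.2 hB) (sq_nonneg ξ), sq_nonneg ξ]
  have d₂ (ξ : ℝ) : |ε ^ 2 * χ'' (ε * ξ) - 8 * ξ * (ε * χ' (ε * ξ)) +
      (16 * ξ ^ 2 - 4) * χ (ε * ξ)| ≤ B * 9 + B * 20 * ξ ^ 2 := by
    have t : |8 * ξ * (ε * χ' (ε * ξ))| ≤ B * (4 + 4 * ξ ^ 2) := by
      rw [abs_mul, abs_mul, abs_of_pos (by norm_num : (0 : ℝ) < 8), mul_comm B]
      exact mul_le_mul (by linarith [aux ξ]) (c₁ ξ) (abs_nonneg _) (by positivity)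
    have t' : |(16 * ξ ^ 2 - 4) * χ (ε * ξ)| ≤ B * (16 * ξ ^ 2 + 4) := by
      rw [abs_mul, mul_comm B]
      refine mul_le_mul ?_ ((b₀ _).trans hB) (abs_nonneg _) (by positivity)
      rw [abs_le]; constructor <;> nlinarith [sq_nonneg ξ]
    have := abs_add_le (ε ^ 2 * χ'' (ε * ξ) - 8 * ξ * (ε * χ' (ε * ξ)))
      ((16 * ξ ^ 2 - 4) * χ (ε * ξ))
    have := abs_sub (ε ^ 2 * χ'' (ε * ξ)) (8 * ξ * (ε * χ' (ε * ξ)))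
    linarith [c₂ ξ]
  have i₀ : Integrable fun ξ => (u ξ : ℂ) :=
    hint.mono' (by fun_prop) (.of_forall (dom d₀))
  have i₁ : Integrable fun ξ => (u' ξ : ℂ) :=
    hint.mono' (by fun_prop) (.of_forall (dom d₁))
  have i₂ : Integrable fun ξ => (u'' ξ : ℂ) :=
    hint.mono' (by fun_prop) (.of_forall (dom d₂))
  refine (norm_fourierInv_le_of_hasDerivAt i₀ i₁ i₂ (fun ξ => (h₁ ξ).ofReal_comp)
    (fun ξ => (h₂ ξ).ofReal_comp) x).trans ?_
  refine mul_le_mul_of_nonneg_right ?_ (by positivity)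
  rw [two_mul]
  exact add_le_add (integral_mono i₀.norm hint (dom d₀)) (integral_mono i₂.norm hint (dom d₂))

open FourierTransform Filter Topology in
theorem exists_compactSupport_gaussian_approx :
    ∃ (H : ℕ → ℝ → ℂ) (A : ℝ), 0 ≤ A ∧ (∀ n, ContDiff ℝ (⊤ : ℕ∞) (H n)) ∧
      (∀ n, HasCompactSupport (H n)) ∧ (∀ n ξ, ‖H n ξ‖ ≤ Real.exp (-2 * ξ ^ 2)) ∧
      (∀ ξ, Tendsto (fun n => H n ξ) atTop (𝓝 (Real.exp (-2 * ξ ^ 2) : ℂ))) ∧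
      ∀ n x, ‖𝓕⁻ (H n) x‖ ≤ A * (1 + x ^ 2)⁻¹ := by
  obtain ⟨χ, χ', χ'', B, hB, hs, hcs, hχ, hχ', hc, h0, b₀, b₁, b₂⟩ := exists_smooth_cutoff
  have pos (n : ℕ) : (0 : ℝ) < 1 / (n + 1) := by positivity
  refine ⟨fun n ξ => ((χ (1 / ((n : ℝ) + 1) * ξ) * Real.exp (-2 * ξ ^ 2) : ℝ) : ℂ),
    2 * ∫ ξ : ℝ, (B * 9 + B * 20 * ξ ^ 2) * Real.exp (-2 * ξ ^ 2), ?_, fun n => ?_, fun n => ?_,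
    fun n ξ => ?_, fun ξ => ?_, fun n x => ?_⟩
  · have : 0 ≤ B := zero_le_one.trans hB
    exact mul_nonneg zero_le_two (integral_nonneg fun ξ => by positivity)
  · exact Complex.ofRealCLM.contDiff.comp
      ((hs.comp (contDiff_const.mul contDiff_id)).mul
        (Real.contDiff_exp.comp (contDiff_const.mul (contDiff_id.pow 2))))
  · have : HasCompactSupport fun ξ => χ (1 / ((n : ℝ) + 1) * ξ) :=
      hcs.comp_homeomorph (Homeomorph.mulLeft₀ _ (pos n).ne')
    exact (this.mul_right (f' := fun ξ => Real.exp (-2 * ξ ^ 2))).comp_left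
      (g := ((↑) : ℝ → ℂ)) Complex.ofReal_zero
  · rw [Complex.norm_real, Real.norm_eq_abs, abs_mul, abs_of_pos (Real.exp_pos _)]
    exact mul_le_of_le_one_left (Real.exp_pos _).le (b₀ _)
  · have t : Tendsto (fun n : ℕ => 1 / ((n : ℝ) + 1) * ξ) atTop (𝓝 (0 * ξ)) :=
      tendsto_one_div_add_atTop_nhds_zero_nat.mul_const ξ
    rw [zero_mul] at t
    have t' := ((hχ 0).continuousAt.tendsto.comp t).mul_const (Real.exp (-2 * ξ ^ 2))
    rw [h0, one_mul] at t'
    exact (Complex.continuous_ofReal.tendsto _).comp t'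
  · refine norm_fourierInv_cutoff_gaussian_le hB hχ hχ' hc b₀ b₁ b₂ (pos n).le ?_ x
    rw [div_le_one (by positivity)]
    linarith [n.cast_nonneg (α := ℝ)]

open FourierTransform in
theorem FT_fourierInv {h : ℝ → ℂ} (hs : HasCompactSupport h) (hd : ContDiff ℝ (⊤ : ℕ∞) h) :
    FT (𝓕⁻ h) = h := by
  have : 𝓕⁻ h = ⇑(𝓕⁻ (hs.toSchwartzMap hd) : SchwartzMap ℝ ℂ) :=
    (SchwartzMap.fourierInv_coe (hs.toSchwartzMap hd)).symm
  rw [FT_eq_fourier, this, ← SchwartzMap.fourier_coe, fourier_fourierInv_eq]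
  rfl

open FourierTransform in
theorem memP_fourierInv {h : ℝ → ℂ} (hs : HasCompactSupport h) (hd : ContDiff ℝ (⊤ : ℕ∞) h) :
    MemP (𝓕⁻ h) :=
  ⟨⟨𝓕⁻ (hs.toSchwartzMap hd), SchwartzMap.fourierInv_coe _⟩, (FT_fourierInv hs hd).symm ▸ hs⟩

open FourierTransform in
theorem fourierInv_comp_mul (h : ℝ → ℂ) {l : ℝ} (hl : 0 < l) (x : ℝ) :
    𝓕⁻ (fun ξ => h (l * ξ)) x = (l⁻¹ : ℝ) • 𝓕⁻ h (l⁻¹ * x) := by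
  rw [Real.fourierInv_eq', Real.fourierInv_eq', ← abs_of_pos (inv_pos.2 hl),
    ← Measure.integral_comp_mul_left, abs_of_pos (inv_pos.2 hl)]
  refine integral_congr_ae (.of_forall fun ξ => ?_)
  simp only [RCLike.inner_apply, conj_trivial]
  congr 5
  field_simp

theorem eLpNorm_comp_inv_mul {g : ℝ → ℂ} (hg : StronglyMeasurable g) (p : ℝ≥0∞) {l : ℝ}
    (hl : 0 < l) :
    eLpNorm (fun x => g (l⁻¹ * x)) p volume =
      ENNReal.ofReal (l ^ (1 / p).toReal) * eLpNorm g p volume := by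
  have h := eLpNorm_map_measure (p := p) (μ := volume) (f := fun x : ℝ => l⁻¹ * x)
    hg.aestronglyMeasurable (by fun_prop)
  rw [Real.map_volume_mul_left (inv_ne_zero hl.ne'), inv_inv, abs_of_pos hl,
    eLpNorm_smul_measure_of_ne_zero (by simpa using hl), ENNReal.ofReal_rpow_of_pos hl,
    smul_eq_mul] at h
  exact h.symm

theorem eLpNorm_inv_one_add_sq_ne_top {p : ℝ≥0∞} (hp : 1 ≤ p) :
    eLpNorm (fun x : ℝ => (((1 + x ^ 2)⁻¹ : ℝ) : ℂ)) p volume ≠ ⊤ := by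
  have hb (x : ℝ) : ‖(((1 + x ^ 2)⁻¹ : ℝ) : ℂ)‖ ≤ 1 := by
    rw [Complex.norm_real, Real.norm_of_nonneg (by positivity)]
    exact inv_le_one_of_one_le₀ (by nlinarith [sq_nonneg x])
  rcases eq_or_ne p ⊤ with rfl | hp'
  · exact ((memLp_top_of_bound (by fun_prop) 1 (.of_forall hb)).2).ne
  · have hp0 : p ≠ 0 := (zero_lt_one.trans_le hp).ne'
    rw [← lt_top_iff_ne_top, eLpNorm_lt_top_iff_lintegral_rpow_enorm_lt_top hp0 hp']
    refine lt_of_le_of_lt (lintegral_mono fun x => ?_) (integrable_inv_one_add_sq.ofReal (𝕜 := ℂ)).2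
    have h1 : ‖(((1 + x ^ 2)⁻¹ : ℝ) : ℂ)‖ₑ ≤ 1 := by
      rw [← ofReal_norm]
      exact ENNReal.ofReal_le_one.2 (hb x)
    refine (ENNReal.rpow_le_rpow_of_exponent_ge h1
      (z := 1) ((ENNReal.ofReal_le_iff_le_toReal hp').1 (by simpa using hp))).trans ?_
    rw [ENNReal.rpow_one]
    rfl

open FourierTransform in
theorem eLpNorm_fourierInv_comp_mul_le {h : ℝ → ℂ} {A : ℝ} (hA : 0 ≤ A)
    (hb : ∀ x, ‖𝓕⁻ h x‖ ≤ A * (1 + x ^ 2)⁻¹) (p : ℝ≥0∞) {l : ℝ} (hl : 0 < l) :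
    eLpNorm (𝓕⁻ fun ξ => h (l * ξ)) p volume ≤
      ENNReal.ofReal (l⁻¹ * A * l ^ (1 / p).toReal) *
        eLpNorm (fun x : ℝ => (((1 + x ^ 2)⁻¹ : ℝ) : ℂ)) p volume := by
  have e := eLpNorm_comp_inv_mul (g := fun x : ℝ => (((1 + x ^ 2)⁻¹ : ℝ) : ℂ))
    (Measurable.stronglyMeasurable (by fun_prop)) p hl
  rw [ENNReal.ofReal_mul (by positivity), mul_assoc, ← e]
  refine (eLpNorm_le_mul_eLpNorm_of_ae_le_mul (c := l⁻¹ * A) (.of_forall fun x => ?_) p)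
  rw [fourierInv_comp_mul h hl, norm_smul, Complex.norm_real, Real.norm_of_nonneg (by positivity),
    Real.norm_of_nonneg (by positivity), mul_assoc]
  exact mul_le_mul_of_nonneg_left (hb _) (by positivity)

theorem measurePreserving_sub_half_add :
    MeasurePreserving (fun z : ℝ × ℝ => (z.1 - z.2, z.2 + (z.1 - z.2) / 2)) volume volume := by
  have h₁ : MeasurePreserving (fun z : ℝ × ℝ => (z.1 - z.2, z.2)) volume volume :=
    measurePreserving_sub_prod volume volume
  have h₂ : MeasurePreserving (fun z : ℝ × ℝ => (z.1, z.2 + z.1 / 2)) volume volume :=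
    (MeasurePreserving.id volume).skew_product (g := fun a c : ℝ => c + a / 2)
      (by unfold Function.uncurry; fun_prop)
      (.of_forall fun a => (measurePreserving_add_right volume (a / 2)).map_eq)
  exact h₂.comp h₁

/-- The Fourier transform of a Gaussian, normalised as it appears in `Bm` of two Gaussians. -/
noncomputable def gaussianKernel (l x : ℝ) : ℂ :=
  ∫ a : ℝ, (Real.exp (-(4 * l ^ 2 * a ^ 2)) : ℂ) *
    Complex.exp ((4 * Real.pi * a * x) * Complex.I)

theorem gaussianKernel_eq {l : ℝ} (hl : 0 < l) (x : ℝ) :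
    gaussianKernel l x = (l⁻¹ : ℝ) • gaussianKernel 1 (l⁻¹ * x) := by
  rw [gaussianKernel, gaussianKernel, ← abs_of_pos (inv_pos.2 hl),
    ← Measure.integral_comp_mul_left, abs_of_pos (inv_pos.2 hl)]
  refine integral_congr_ae (.of_forall fun a => ?_)
  have : (l : ℂ) ≠ 0 := by exact_mod_cast hl.ne'
  simp only
  congr 3
  · ring
  · push_cast
    field_simp

theorem gaussianKernel_one (x : ℝ) :
    gaussianKernel 1 x = (Real.pi / 4 : ℂ) ^ (1 / 2 : ℂ) *
      Complex.exp (-(4 * Real.pi * x : ℂ) ^ 2 / (4 * 4)) := by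
  rw [← fourierIntegral_gaussian (b := 4) (by norm_num), gaussianKernel]
  refine integral_congr_ae (.of_forall fun a => ?_)
  simp only
  push_cast
  rw [mul_comm]
  ring_nf

theorem gaussianKernel_one_ne_zero (x : ℝ) : gaussianKernel 1 x ≠ 0 := by
  rw [gaussianKernel_one]
  refine mul_ne_zero ?_ (Complex.exp_ne_zero _)
  rw [Complex.cpow_def_of_ne_zero (by simp [Real.pi_ne_zero])]
  exact Complex.exp_ne_zero _

theorem stronglyMeasurable_gaussianKernel_one : StronglyMeasurable (gaussianKernel 1) := by
  rw [show gaussianKernel 1 = _ from funext gaussianKernel_one]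
  exact Continuous.stronglyMeasurable (by fun_prop)

theorem eLpNorm_gaussianKernel (p : ℝ≥0∞) {l : ℝ} (hl : 0 < l) :
    eLpNorm (gaussianKernel l) p volume =
      ENNReal.ofReal (l⁻¹ * l ^ (1 / p).toReal) * eLpNorm (gaussianKernel 1) p volume := by
  have : gaussianKernel l = (l⁻¹ : ℝ) • fun x => gaussianKernel 1 (l⁻¹ * x) :=
    funext (gaussianKernel_eq hl)
  rw [this, eLpNorm_const_smul, eLpNorm_comp_inv_mul stronglyMeasurable_gaussianKernel_one p hl,
    ENNReal.ofReal_mul (by positivity), mul_assoc, Real.enorm_of_nonneg (by positivity)]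

theorem eLpNorm_gaussianKernel_one_ne_zero {p : ℝ≥0∞} (hp : 0 < p) :
    eLpNorm (gaussianKernel 1) p volume ≠ 0 := by
  rw [Ne, eLpNorm_eq_zero_iff stronglyMeasurable_gaussianKernel_one.aestronglyMeasurable hp.ne']
  intro h
  obtain ⟨x, hx⟩ := h.exists
  exact gaussianKernel_one_ne_zero x hx

theorem gaussian_mul_gaussian (l ξ η : ℝ) :
    Real.exp (-2 * (l * ξ) ^ 2) * Real.exp (-2 * (l * η) ^ 2) =
      Real.exp (-(l ^ 2 * (ξ - η) ^ 2)) *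
        Real.exp (-(4 * l ^ 2 * (η + (ξ - η) / 2) ^ 2)) := by
  rw [← Real.exp_add, ← Real.exp_add]
  ring_nf

theorem integrable_gaussian_mul_gaussian_mul {M : ℝ → ℂ} {l : ℝ} (hl : 0 < l)
    (hM : Integrable fun ξ : ℝ => (Real.exp (-(l ^ 2 * ξ ^ 2)) : ℂ) * M ξ) :
    Integrable fun z : ℝ × ℝ =>
      Real.exp (-2 * (l * z.1) ^ 2) * Real.exp (-2 * (l * z.2) ^ 2) * ‖M (z.1 - z.2)‖ := by
  have hG : Integrable fun a : ℝ => Real.exp (-(4 * l ^ 2 * a ^ 2)) := by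
    simpa using integrable_exp_neg_mul_sq (b := 4 * l ^ 2) (by positivity)
  have h := measurePreserving_sub_half_add.integrable_comp_of_integrable (hM.norm.mul_prod hG)
  refine h.congr (.of_forall fun z => ?_)
  simp only [Function.comp_apply, gaussian_mul_gaussian, norm_mul, Complex.norm_real,
    Real.norm_of_nonneg (Real.exp_pos _).le]
  ring

theorem integral_gaussian_mul_gaussian_mul {M : ℝ → ℂ} (hM : Measurable M) (l x : ℝ) :
    ∫ z : ℝ × ℝ, (Real.exp (-2 * (l * z.1) ^ 2) : ℂ) * (Real.exp (-2 * (l * z.2) ^ 2) : ℂ) *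
        M (z.1 - z.2) * Complex.exp ((2 * Real.pi * (z.1 + z.2) * x) * Complex.I) =
      (∫ ξ : ℝ, (Real.exp (-(l ^ 2 * ξ ^ 2)) : ℂ) * M ξ) * gaussianKernel l x := by
  let F : ℝ × ℝ → ℂ := fun z => (Real.exp (-(l ^ 2 * z.1 ^ 2)) : ℂ) * M z.1 *
    ((Real.exp (-(4 * l ^ 2 * z.2 ^ 2)) : ℂ) *
      Complex.exp ((4 * Real.pi * z.2 * x) * Complex.I))
  have hF : AEStronglyMeasurable F
      (Measure.map (fun z : ℝ × ℝ => (z.1 - z.2, z.2 + (z.1 - z.2) / 2)) volume) :=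
    Measurable.aestronglyMeasurable (by fun_prop)
  have h := integral_map (by fun_prop) hF
  rw [measurePreserving_sub_half_add.map_eq] at h
  rw [gaussianKernel, ← integral_prod_mul, ← Measure.volume_eq_prod]
  refine Eq.trans ?_ h.symm
  refine integral_congr_ae (.of_forall fun z => ?_)
  have e := congrArg ((↑) : ℝ → ℂ) (gaussian_mul_gaussian l z.1 z.2)
  rw [Complex.ofReal_mul, Complex.ofReal_mul] at e
  simp only [F, e]
  have e' : (4 * Real.pi * ((z.2 + (z.1 - z.2) / 2 : ℝ) : ℂ) * x) =
      2 * Real.pi * (z.1 + z.2) * x := by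
    push_cast; ring
  rw [e']
  ring

theorem aestronglyMeasurable_Bm {m : ℝ × ℝ → ℂ} (hm : Measurable m) {f g : ℝ → ℂ}
    (hf : Continuous (FT f)) (hg : Continuous (FT g)) :
    AEStronglyMeasurable (Bm m f g) volume := by
  have h : StronglyMeasurable fun z : ℝ × (ℝ × ℝ) => FT f z.2.1 * FT g z.2.2 * m z.2 *
      Complex.exp ((2 * Real.pi * (z.2.1 + z.2.2) * z.1) * Complex.I) := by
    have := hf.measurable
    have := hg.measurable
    exact Measurable.stronglyMeasurable (by fun_prop)
  exact (h.integral_prod_right' (ν := volume)).aestronglyMeasurable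

open FourierTransform Filter Topology in
/-- Testing a bilinear multiplier bound on approximations of Gaussians. -/
theorem norm_integral_gaussian_mul_le {p₁ p₂ p₃ : ℝ≥0∞} (hp₁ : 1 ≤ p₁) (hp₂ : 1 ≤ p₂)
    (hp₃ : 0 < p₃) : ∃ K : ℝ, 0 < K ∧ ∀ M : ℝ → ℂ, Measurable M → ∀ C : ℝ, 0 ≤ C →
      (∀ f g : ℝ → ℂ, MemP f → MemP g →
        eLpNorm (Bm (fun ξη => M (ξη.1 - ξη.2)) f g) p₃ volume ≤
          ENNReal.ofReal C * eLpNorm f p₁ volume * eLpNorm g p₂ volume) →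
      ∀ l : ℝ, 0 < l → ‖∫ ξ : ℝ, (Real.exp (-(l ^ 2 * ξ ^ 2)) : ℂ) * M ξ‖ ≤
        K * C * l ^ ((1 / p₁).toReal + (1 / p₂).toReal - (1 / p₃).toReal - 1) := by
  obtain ⟨H, A, hA, hd, hs, hb, ht, hF⟩ := exists_compactSupport_gaussian_approx
  set w₁ := eLpNorm (fun x : ℝ => (((1 + x ^ 2)⁻¹ : ℝ) : ℂ)) p₁ volume
  set w₂ := eLpNorm (fun x : ℝ => (((1 + x ^ 2)⁻¹ : ℝ) : ℂ)) p₂ volume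
  have hw₁ : w₁ ≠ ⊤ := eLpNorm_inv_one_add_sq_ne_top hp₁
  have hw₂ : w₂ ≠ ⊤ := eLpNorm_inv_one_add_sq_ne_top hp₂
  set κ := min (eLpNorm (gaussianKernel 1) p₃ volume) 1
  have hκt : κ ≠ ⊤ := ((min_le_right _ _).trans_lt one_lt_top).ne
  have hκ : 0 < κ.toReal := ENNReal.toReal_pos
    (lt_min (pos_iff_ne_zero.2 (eLpNorm_gaussianKernel_one_ne_zero hp₃)) one_pos).ne' hκt
  have hW : 0 ≤ A ^ 2 * w₁.toReal * w₂.toReal / κ.toReal := by positivity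
  refine ⟨A ^ 2 * w₁.toReal * w₂.toReal / κ.toReal + 1, by linarith,
    fun M hM C hC hbd l hl => ?_⟩
  by_cases hint : Integrable fun ξ : ℝ => (Real.exp (-(l ^ 2 * ξ ^ 2)) : ℂ) * M ξ
  swap
  · rw [integral_undef hint, norm_zero]
    positivity
  set I := ∫ ξ : ℝ, (Real.exp (-(l ^ 2 * ξ ^ 2)) : ℂ) * M ξ
  set s₁ := (1 / p₁).toReal
  set s₂ := (1 / p₂).toReal
  set s₃ := (1 / p₃).toReal
  let h : ℕ → ℝ → ℂ := fun n ξ => H n (l * ξ)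
  have hhs (n : ℕ) : HasCompactSupport (h n) :=
    (hs n).comp_homeomorph (Homeomorph.mulLeft₀ l hl.ne')
  have hhd (n : ℕ) : ContDiff ℝ (⊤ : ℕ∞) (h n) := (hd n).comp (contDiff_const.mul contDiff_id)
  have hlim (x : ℝ) : Tendsto
      (fun n => Bm (fun ξη => M (ξη.1 - ξη.2)) (𝓕⁻ (h n)) (𝓕⁻ (h n)) x) atTop
      (𝓝 ((I • gaussianKernel l) x)) := by
    rw [Pi.smul_apply, smul_eq_mul, ← integral_gaussian_mul_gaussian_mul hM]
    simp only [Bm, FT_fourierInv (hhs _) (hhd _)]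
    refine tendsto_integral_of_dominated_convergence _ (fun n => ?_)
      (integrable_gaussian_mul_gaussian_mul hl hint) (fun n => .of_forall fun z => ?_)
      (.of_forall fun z => ?_)
    · have := (hhd n).continuous.measurable
      exact Measurable.aestronglyMeasurable (by fun_prop)
    · have : ‖Complex.exp ((2 * Real.pi * (z.1 + z.2) * x) * Complex.I)‖ = 1 := by
        rw [← Complex.norm_exp_ofReal_mul_I (2 * Real.pi * (z.1 + z.2) * x)]
        push_cast
        rfl
      rw [norm_mul, this, mul_one, norm_mul, norm_mul]
      gcongr
      · exact hb n _
      · exact hb n _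
    · exact (((ht _).mul (ht _)).mul_const _).mul_const _
  have hfatou := Lp.eLpNorm_lim_le_liminf_eLpNorm (p := p₃) (μ := volume)
    (fun n => aestronglyMeasurable_Bm (m := fun ξη => M (ξη.1 - ξη.2)) (by fun_prop)
      ((FT_fourierInv (hhs n) (hhd n)).symm ▸ (hhd n).continuous)
      ((FT_fourierInv (hhs n) (hhd n)).symm ▸ (hhd n).continuous)) _ (.of_forall hlim)
  have hle (n : ℕ) : eLpNorm (Bm (fun ξη => M (ξη.1 - ξη.2)) (𝓕⁻ (h n)) (𝓕⁻ (h n))) p₃ volume ≤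
      ENNReal.ofReal C * (ENNReal.ofReal (l⁻¹ * A * l ^ s₁) * w₁) *
        (ENNReal.ofReal (l⁻¹ * A * l ^ s₂) * w₂) := by
    refine (hbd _ _ (memP_fourierInv (hhs n) (hhd n)) (memP_fourierInv (hhs n) (hhd n))).trans ?_
    gcongr
    · exact eLpNorm_fourierInv_comp_mul_le hA (hF n) p₁ hl
    · exact eLpNorm_fourierInv_comp_mul_le hA (hF n) p₂ hl
  have hmain := hfatou.trans ((liminf_le_liminf (.of_forall hle)).trans_eq (liminf_const _))
  rw [eLpNorm_const_smul, eLpNorm_gaussianKernel p₃ hl] at hmain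
  have hκle : ‖I‖ₑ * (ENNReal.ofReal (l⁻¹ * l ^ s₃) * κ) ≤
      ENNReal.ofReal C * (ENNReal.ofReal (l⁻¹ * A * l ^ s₁) * w₁) *
        (ENNReal.ofReal (l⁻¹ * A * l ^ s₂) * w₂) :=
    le_trans (by gcongr; exact min_le_left _ _) hmain
  have hreal := ENNReal.toReal_mono (by finiteness) hκle
  simp only [ENNReal.toReal_mul, toReal_enorm] at hreal
  rw [ENNReal.toReal_ofReal hC, ENNReal.toReal_ofReal (by positivity),
    ENNReal.toReal_ofReal (by positivity), ENNReal.toReal_ofReal (by positivity)] at hreal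
  have hpow : l ^ (s₁ + s₂ - s₃ - 1) = l ^ s₁ * l ^ s₂ / (l ^ s₃ * l) := by
    rw [Real.rpow_sub hl, Real.rpow_sub hl, Real.rpow_add hl, Real.rpow_one, div_div]
  have h3 : 0 < l ^ s₃ := by positivity
  calc ‖I‖ = ‖I‖ * (l⁻¹ * l ^ s₃ * κ.toReal) * (l / (l ^ s₃ * κ.toReal)) := by field_simp
    _ ≤ C * (l⁻¹ * A * l ^ s₁ * w₁.toReal) * (l⁻¹ * A * l ^ s₂ * w₂.toReal) *
        (l / (l ^ s₃ * κ.toReal)) := by gcongr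
    _ = A ^ 2 * w₁.toReal * w₂.toReal / κ.toReal * C * l ^ (s₁ + s₂ - s₃ - 1) := by
      rw [hpow]; field_simp
    _ ≤ _ := by
      gcongr
      linarith

theorem stmt17 (p₁ p₂ p₃ : ℝ≥0∞) (hp₁ : 1 ≤ p₁) (hp₂ : 1 ≤ p₂) (hp₃ : 0 < p₃)
    (M : ℝ → ℂ) (hMmeas : Measurable M)
    (hM : IsBiMult p₁ p₂ p₃ (fun ξη => M (ξη.1 - ξη.2)))
    (q : ℝ) (hq : 1 / q = (1 / p₁).toReal + (1 / p₂).toReal - (1 / p₃).toReal) :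
    ∃ C : ℝ, 0 < C ∧ ∀ l : ℝ, 0 < l →
      ‖∫ ξ : ℝ, (Real.exp (-(l ^ 2 * ξ ^ 2)) : ℂ) * M ξ‖ ≤
        C * biNorm p₁ p₂ p₃ (fun ξη => M (ξη.1 - ξη.2)) * l ^ (1 / q - 1) := by
  obtain ⟨K, hK, hbd⟩ := norm_integral_gaussian_mul_le hp₁ hp₂ hp₃
  refine ⟨K, hK, fun l hl => ?_⟩
  rw [hq]
  set t := l ^ ((1 / p₁).toReal + (1 / p₂).toReal - (1 / p₃).toReal - 1)
  have ht : 0 < t := Real.rpow_pos_of_pos hl _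
  obtain ⟨C₀, hC₀, hC₀'⟩ := hM
  rw [mul_right_comm, ← div_le_iff₀' (mul_pos hK ht)]
  refine le_csInf ⟨C₀, hC₀.le, hC₀'⟩ fun C hC => ?_
  rw [div_le_iff₀' (mul_pos hK ht), mul_right_comm]
  exact hbd M hMmeas C hC.1 hC.2 l hl
end
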